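/- arXiv:2306.02662 — 5 statements merged into one kernel-verified Lean document; each statement's English description precedes it below -/
import Mathlib

section
/- Let G = (V,E,w) be a weighted digraph and let p be a path from s to t that is strongly-hop-dominant, i.e., |p| ≤ 4|p| and w(p) ≤ w(q) for every s-t path q with |q| ≤ 4|p|. Then for every k with 0 ≤ k ≤ |p|, both the prefix p[0,k] (a path from s to p[k]) and the suffix p[k,|p|] (a path from p[k] to t) are strongly-hop-dominant: p[0,k] is 4k-hop shortest from s to p[k], and p[k,|p|] is 4(|p|−k)-hop shortest from p[k] to t. -/
/-- A path in a digraph with edge relation `E`: a nonempty list of vertices starting at `s`,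
ending at `t`, with every consecutive pair an edge (vertices may repeat). -/
def IsPath {V : Type*} (E : V → V → Prop) (p : List V) (s t : V) : Prop :=
  p ≠ [] ∧ p.head? = some s ∧ p.getLast? = some t ∧ p.Chain' E

/-- The hop of a path: its number of edges. -/
def hop {V : Type*} (p : List V) : ℕ := p.length - 1

/-- The weight of a path: the sum of the weights of its consecutive edges. -/
def pweight {V : Type*} (w : V → V → ℝ) (p : List V) : ℝ :=
  ((p.zip p.tail).map fun e => w e.1 e.2).sum

/-- `p` is an `h`-hop shortest path from `s` to `t`: it is an `s`-`t` path with `|p| ≤ h`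
that is at most as long as every `s`-`t` path with hop at most `h`. -/
def IsHopShortest {V : Type*} (E : V → V → Prop) (w : V → V → ℝ) (p : List V)
    (s t : V) (h : ℕ) : Prop :=
  IsPath E p s t ∧ hop p ≤ h ∧
    ∀ q : List V, IsPath E q s t → hop q ≤ h → pweight w p ≤ pweight w q

theorem pweight_append_cons {V : Type*} (w : V → V → ℝ) (l : List V) (v : V) (r : List V) :
    pweight w (l ++ v :: r) = pweight w (l ++ [v]) + pweight w (v :: r) := by
  induction l with
  | nil => simp [pweight]
  | cons a l ih =>
    cases l with
    | nil => simp [pweight]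
    | cons b l =>
      simp only [pweight, List.cons_append, List.tail_cons, List.zip_cons_cons, List.map_cons,
        List.sum_cons] at ih ⊢
      rw [ih, add_assoc]

theorem isPath_append_cons {V : Type*} {E : V → V → Prop} {l r : List V} {s t v : V} :
    IsPath E (l ++ v :: r) s t ↔ IsPath E (l ++ [v]) s v ∧ IsPath E (v :: r) v t := by
  have hchain : (l ++ v :: r).IsChain E ↔ (l ++ [v]).IsChain E ∧ (v :: r).IsChain E :=
    List.isChain_split
  have hhead : (l ++ v :: r).head? = (l ++ [v]).head? := by cases l <;> rfl
  have hlast : (l ++ v :: r).getLast? = (v :: r).getLast? := by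
    simp [List.getLast?_append, List.getLast?_cons]
  have hlast' : (l ++ [v]).getLast? = some v := by simp
  have hne : l ++ v :: r ≠ [] := by simp
  have hne' : l ++ [v] ≠ [] := by simp
  have hne'' : v :: r ≠ [] := by simp
  have hhead' : (v :: r).head? = some v := rfl
  unfold IsPath
  change _ ∧ _ ∧ _ ∧ List.IsChain _ _ ↔
    (_ ∧ _ ∧ _ ∧ List.IsChain _ _) ∧ _ ∧ _ ∧ _ ∧ List.IsChain _ _
  rw [hchain, hhead, hlast]
  tauto

theorem IsPath.exists_eq_concat {V : Type*} {E : V → V → Prop} {q : List V} {s t : V}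
    (hq : IsPath E q s t) : ∃ l, q = l ++ [t] :=
  List.getLast?_eq_some_iff.mp hq.2.2.1

theorem IsPath.exists_eq_cons {V : Type*} {E : V → V → Prop} {q : List V} {s t : V}
    (hq : IsPath E q s t) : ∃ r, q = s :: r :=
  List.head?_eq_some_iff.mp hq.2.1

/-- if `p` is a strongly-hop-dominant `s`-`t` path (i.e. `4|p|`-hop shortest),
then for every `0 ≤ k ≤ |p|`, the prefix `p[0,k]` is a `4k`-hop shortest path from `s` to
`p[k]`, and the suffix `p[k,|p|]` is a `4(|p|-k)`-hop shortest path from `p[k]` to `t`;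
in particular both segments are strongly-hop-dominant. -/
theorem stmt_2 {V : Type*} (E : V → V → Prop) (w : V → V → ℝ) (p : List V) (s t : V)
    (hp : IsHopShortest E w p s t (4 * hop p)) (k : ℕ) (hk : k ≤ hop p) :
    IsHopShortest E w (p.take (k + 1)) s (p.getD k s) (4 * k) ∧
    IsHopShortest E w (p.drop k) (p.getD k s) t (4 * (hop p - k)) := by
  obtain ⟨hpath, -, hmin⟩ := hp
  have hpos : 0 < p.length := List.length_pos_of_ne_nil hpath.1
  have hlt : k < p.length := by unfold hop at hk; omega
  obtain ⟨l, v, r, rfl, rfl⟩ : ∃ l v r, p = l ++ v :: r ∧ l.length = k :=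
    ⟨p.take k, p[k], p.drop (k + 1), by simp, by simp; omega⟩
  have htake : (l ++ v :: r).take (l.length + 1) = l ++ [v] := by
    simp [List.take_append]
  have hdrop : (l ++ v :: r).drop l.length = v :: r := by simp
  have hget : (l ++ v :: r).getD l.length s = v := by simp
  rw [htake, hdrop, hget]
  obtain ⟨hpre, hsuf⟩ := isPath_append_cons.mp hpath
  refine ⟨⟨hpre, by simp [hop]; omega, fun q hq hqh => ?_⟩,
    ⟨hsuf, by simp [hop]; omega, fun q hq hqh => ?_⟩⟩
  · obtain ⟨l', rfl⟩ := hq.exists_eq_concat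
    have h := hmin (l' ++ v :: r) (isPath_append_cons.mpr ⟨hq, hsuf⟩)
      (by simp [hop] at hqh ⊢; omega)
    rw [pweight_append_cons w l, pweight_append_cons w l'] at h
    linarith
  · obtain ⟨r', rfl⟩ := hq.exists_eq_cons
    have h := hmin (l ++ v :: r') (isPath_append_cons.mpr ⟨hpre, hq⟩)
      (by simp [hop] at hqh ⊢; omega)
    rw [pweight_append_cons w l v r, pweight_append_cons w l v r'] at h
    linarith
end

section
/- Let X_1, …, X_n, Y_1, …, Y_n be random variables taking values in [0,1], and let ε ∈ [0, 1/2). Suppose that for each i, E[X_i | X_1, …, X_{i−1}, Y_1, …, Y_i] ≥ Y_i almost surely. Then for any δ > 0, Pr[ Σ_{i=1}^{n} X_i ≤ (1−ε)·Σ_{i=1}^{n} Y_i − δ ] ≤ (1−ε)^{δ}. -/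
open MeasureTheory ProbabilityTheory

/-- A lower bound on a conditional expectation can be integrated against a nonnegative
weight that is measurable with respect to the conditioning σ-algebra. -/
theorem integral_mul_le_integral_mul_of_le_condExp {Ω : Type*} {m m0 : MeasurableSpace Ω}
    {μ : Measure Ω} (hm : m ≤ m0) [SigmaFinite (μ.trim hm)] {W X Y : Ω → ℝ}
    (hW : StronglyMeasurable[m] W) (hW0 : 0 ≤ W) (hX : Integrable X μ)
    (hWX : Integrable (W * X) μ) (hWY : Integrable (W * Y) μ) (hYX : Y ≤ᵐ[μ] μ[X | m]) :
    ∫ ω, W ω * Y ω ∂μ ≤ ∫ ω, W ω * X ω ∂μ := by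
  have hpull := condExp_mul_of_stronglyMeasurable_left hW hWX hX
  calc ∫ ω, W ω * Y ω ∂μ ≤ ∫ ω, (μ[W * X | m]) ω ∂μ := by
        refine integral_mono_ae hWY integrable_condExp ?_
        filter_upwards [hpull, hYX] with ω h₁ h₂
        rw [h₁]
        exact mul_le_mul_of_nonneg_left h₂ (hW0 ω)
    _ = ∫ ω, W ω * X ω ∂μ := integral_condExp hm

theorem exp_log_mul_le_one_sub_mul {ε x : ℝ} (hε : ε < 1) (hx : x ∈ Set.Icc (0 : ℝ) 1) :
    Real.exp (Real.log (1 - ε) * x) ≤ 1 - ε * x := by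
  have h := convexOn_exp.2 (Set.mem_univ 0) (Set.mem_univ (Real.log (1 - ε)))
    (sub_nonneg.2 hx.2) hx.1 (by ring)
  simp only [smul_eq_mul, mul_zero, zero_add, Real.exp_zero,
    Real.exp_log (sub_pos.2 hε)] at h
  rw [mul_comm]
  linarith

theorem exp_neg_log_mul_mul_one_sub_mul_le_one {ε y : ℝ} (hε : ε < 1) (hy : 0 ≤ y) :
    Real.exp (-(Real.log (1 - ε) * ((1 - ε) * y))) * (1 - ε * y) ≤ 1 := by
  have hpos : 0 < 1 - ε := sub_pos.2 hε
  have hlog : -ε ≤ (1 - ε) * Real.log (1 - ε) := by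
    have h := mul_le_mul_of_nonneg_left (Real.one_sub_inv_le_log_of_pos hpos) hpos.le
    rw [mul_sub, mul_inv_cancel₀ hpos.ne'] at h
    linarith
  have hexp : 1 - ε * y ≤ Real.exp (Real.log (1 - ε) * ((1 - ε) * y)) := by
    have h₁ := Real.add_one_le_exp (-(ε * y))
    have h₂ : Real.exp (-(ε * y)) ≤ Real.exp (Real.log (1 - ε) * ((1 - ε) * y)) :=
      Real.exp_le_exp.2 (by nlinarith [mul_le_mul_of_nonneg_right hlog hy])
    linarith
  calc _ ≤ _ := mul_le_mul_of_nonneg_left hexp (Real.exp_nonneg _)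
    _ = 1 := by rw [← Real.exp_add, neg_add_cancel, Real.exp_zero]

/-- online Chernoff bound: let `X 1, …, X n, Y 1, …, Y n` be `[0,1]`-valued
random variables and `ε ∈ [0, 1/2)`. If for each `i`,
`E[X i | X 1, …, X (i-1), Y 1, …, Y i] ≥ Y i` almost surely, then for any `δ > 0`,
`Pr[∑ X i ≤ (1-ε) ∑ Y i - δ] ≤ (1-ε)^δ`. (Indices are 0-based: the conditioning
σ-algebra for step `i` is generated by `X j` for `j < i` and `Y j` for `j ≤ i`.) -/
theorem stmt_6 {Ω : Type*} [m0 : MeasurableSpace Ω] (μ : Measure Ω)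
    [IsProbabilityMeasure μ]
    (n : ℕ) (X Y : ℕ → Ω → ℝ)
    (hXmeas : ∀ i, Measurable (X i)) (hYmeas : ∀ i, Measurable (Y i))
    (hXrange : ∀ i, ∀ ω, X i ω ∈ Set.Icc (0 : ℝ) 1)
    (hYrange : ∀ i, ∀ ω, Y i ω ∈ Set.Icc (0 : ℝ) 1)
    (ε : ℝ) (hε : ε ∈ Set.Ico (0 : ℝ) (1 / 2))
    (hcond : ∀ i, ∀ᵐ ω ∂μ, Y i ω ≤
      (μ[X i | (⨆ j : Fin i, MeasurableSpace.comap (X j) inferInstance) ⊔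
               (⨆ j : Fin (i + 1), MeasurableSpace.comap (Y j) inferInstance)]) ω)
    (δ : ℝ) (hδ : 0 < δ) :
    (μ {ω | ∑ i ∈ Finset.range n, X i ω ≤
        (1 - ε) * ∑ i ∈ Finset.range n, Y i ω - δ}).toReal ≤ (1 - ε) ^ δ := by
  have hε1 : ε < 1 := by linarith [hε.2]
  have hpos : 0 < 1 - ε := sub_pos.2 hε1
  set L := Real.log (1 - ε) with hL
  have hL0 : L ≤ 0 := Real.log_nonpos hpos.le (by linarith [hε.1])
  have integrable_of_range {Z : Ω → ℝ} {C : ℝ} (hZ : Measurable Z)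
      (hZC : ∀ ω, Z ω ∈ Set.Icc 0 C) : Integrable Z μ :=
    Integrable.of_bound hZ.aestronglyMeasurable C
      (ae_of_all _ fun ω => by rw [Real.norm_of_nonneg (hZC ω).1]; exact (hZC ω).2)
  let F (a b : ℕ) (ω : Ω) : ℝ := Real.exp
    (L * (∑ i ∈ Finset.range a, X i ω - (1 - ε) * ∑ i ∈ Finset.range b, Y i ω))
  have hFmeas (a b : ℕ) : Measurable (F a b) := by fun_prop
  have hFrange (a b : ℕ) (ω : Ω) : F a b ω ∈ Set.Icc 0 (Real.exp (-L * b)) := by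
    refine ⟨Real.exp_nonneg _, Real.exp_le_exp.2 ?_⟩
    have hX0 : 0 ≤ ∑ i ∈ Finset.range a, X i ω :=
      Finset.sum_nonneg fun i _ => (hXrange i ω).1
    have hY0 : 0 ≤ ∑ i ∈ Finset.range b, Y i ω :=
      Finset.sum_nonneg fun i _ => (hYrange i ω).1
    have hYb : ∑ i ∈ Finset.range b, Y i ω ≤ b := by
      simpa using Finset.sum_le_sum fun i (_ : i ∈ Finset.range b) => (hYrange i ω).2
    have h : -(b : ℝ) ≤ ∑ i ∈ Finset.range a, X i ω - (1 - ε) * ∑ i ∈ Finset.range b, Y i ω := by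
      nlinarith [mul_nonneg hε.1 hY0]
    nlinarith [mul_le_mul_of_nonpos_left h hL0]
  have hFint (a b : ℕ) : Integrable (F a b) μ := integrable_of_range (hFmeas a b) (hFrange a b)
  have hFmul (a b : ℕ) {Z : Ω → ℝ} (hZ : Measurable Z) (hZr : ∀ ω, Z ω ∈ Set.Icc (0 : ℝ) 1) :
      Integrable (F a b * Z) μ :=
    integrable_of_range ((hFmeas a b).mul hZ) fun ω =>
      ⟨mul_nonneg (hFrange a b ω).1 (hZr ω).1,
        (mul_le_of_le_one_right (hFrange a b ω).1 (hZr ω).2).trans (hFrange a b ω).2⟩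
  have hstep (k : ℕ) : ∫ ω, F (k + 1) (k + 1) ω ∂μ ≤ ∫ ω, F k k ω ∂μ := by
    have hFsub_int {Z : Ω → ℝ} (hZ : Measurable Z) (hZr : ∀ ω, Z ω ∈ Set.Icc (0 : ℝ) 1) :
        Integrable (fun ω => F k (k + 1) ω - ε * (F k (k + 1) ω * Z ω)) μ :=
      (hFint _ _).sub ((hFmul k (k + 1) hZ hZr).const_mul ε)
    have hsplit {Z : Ω → ℝ} (hZ : Measurable Z) (hZr : ∀ ω, Z ω ∈ Set.Icc (0 : ℝ) 1) :
        ∫ ω, (F k (k + 1) ω - ε * (F k (k + 1) ω * Z ω)) ∂μ =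
          ∫ ω, F k (k + 1) ω ∂μ - ε * ∫ ω, F k (k + 1) ω * Z ω ∂μ := by
      rw [← integral_const_mul]
      exact integral_sub (hFint _ _) ((hFmul k (k + 1) hZ hZr).const_mul ε)
    set G : MeasurableSpace Ω :=
      (⨆ j : Fin k, MeasurableSpace.comap (X j) inferInstance) ⊔
        (⨆ j : Fin (k + 1), MeasurableSpace.comap (Y j) inferInstance)
    have hGm : G ≤ m0 :=
      sup_le (iSup_le fun j => (hXmeas j).comap_le) (iSup_le fun j => (hYmeas j).comap_le)
    have hXG (i : ℕ) (hi : i ∈ Finset.range k) : Measurable[G] (X i) :=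
      measurable_iff_comap_le.2 <| le_sup_of_le_left <|
        le_iSup (fun j : Fin k => MeasurableSpace.comap (X j) inferInstance)
          ⟨i, Finset.mem_range.1 hi⟩
    have hYG (i : ℕ) (hi : i ∈ Finset.range (k + 1)) : Measurable[G] (Y i) :=
      measurable_iff_comap_le.2 <| le_sup_of_le_right <|
        le_iSup (fun j : Fin (k + 1) => MeasurableSpace.comap (Y j) inferInstance)
          ⟨i, Finset.mem_range.1 hi⟩
    have hWG : Measurable[G] (F k (k + 1)) :=
      Real.measurable_exp.comp <| Measurable.const_mul
        ((Finset.measurable_fun_sum _ hXG).sub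
          (Measurable.const_mul (Finset.measurable_fun_sum _ hYG) _)) _
    have hkey : ∫ ω, F k (k + 1) ω * Y k ω ∂μ ≤ ∫ ω, F k (k + 1) ω * X k ω ∂μ :=
      integral_mul_le_integral_mul_of_le_condExp hGm hWG.stronglyMeasurable
        (fun ω => (hFrange _ _ ω).1) (integrable_of_range (hXmeas k) (hXrange k))
        (hFmul _ _ (hXmeas k) (hXrange k)) (hFmul _ _ (hYmeas k) (hYrange k)) (hcond k)
    calc ∫ ω, F (k + 1) (k + 1) ω ∂μ
        ≤ ∫ ω, (F k (k + 1) ω - ε * (F k (k + 1) ω * X k ω)) ∂μ := by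
          refine integral_mono (hFint _ _) (hFsub_int (hXmeas k) (hXrange k)) fun ω => ?_
          have hF : F (k + 1) (k + 1) ω = F k (k + 1) ω * Real.exp (L * X k ω) := by
            simp only [F, ← Real.exp_add, Finset.sum_range_succ (fun i => X i ω)]
            ring_nf
          have h := mul_le_mul_of_nonneg_left
            (exp_log_mul_le_one_sub_mul hε1 (hXrange k ω)) (hFrange k (k + 1) ω).1
          simp only [hF]
          linarith
      _ ≤ ∫ ω, (F k (k + 1) ω - ε * (F k (k + 1) ω * Y k ω)) ∂μ := by
          rw [hsplit (hXmeas k) (hXrange k), hsplit (hYmeas k) (hYrange k)]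
          linarith [mul_le_mul_of_nonneg_left hkey hε.1]
      _ ≤ ∫ ω, F k k ω ∂μ := by
          refine integral_mono (hFsub_int (hYmeas k) (hYrange k)) (hFint _ _) fun ω => ?_
          have hF : F k (k + 1) ω = F k k ω * Real.exp (-(L * ((1 - ε) * Y k ω))) := by
            simp only [F, ← Real.exp_add, Finset.sum_range_succ (fun i => Y i ω)]
            ring_nf
          have h := mul_le_mul_of_nonneg_left
            (exp_neg_log_mul_mul_one_sub_mul_le_one hε1 (hYrange k ω).1) (hFrange k k ω).1
          simp only [hF]
          linarith
  have hF1 : ∀ k, ∫ ω, F k k ω ∂μ ≤ 1 := by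
    intro k
    induction k with
    | zero => simp [F]
    | succ k ih => exact (hstep k).trans ih
  have hsub : {ω | ∑ i ∈ Finset.range n, X i ω ≤ (1 - ε) * ∑ i ∈ Finset.range n, Y i ω - δ} ⊆
      {ω | Real.exp (-(L * δ)) ≤ F n n ω} := by
    intro ω hω
    refine Real.exp_le_exp.2 ?_
    have h : ∑ i ∈ Finset.range n, X i ω - (1 - ε) * ∑ i ∈ Finset.range n, Y i ω ≤ -δ := by
      linarith [hω.out]
    linarith [mul_le_mul_of_nonpos_left h hL0]
  have hmarkov := mul_meas_ge_le_integral_of_nonneg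
    (ae_of_all μ fun ω => (hFrange n n ω).1) (hFint n n) (Real.exp (-(L * δ)))
  rw [Real.rpow_def_of_pos hpos, ← hL]
  calc _ ≤ μ.real {ω | Real.exp (-(L * δ)) ≤ F n n ω} := measureReal_mono hsub
    _ = Real.exp (L * δ) *
          (Real.exp (-(L * δ)) * μ.real {ω | Real.exp (-(L * δ)) ≤ F n n ω}) := by
        rw [← mul_assoc, ← Real.exp_add, add_neg_cancel, Real.exp_zero, one_mul]
    _ ≤ Real.exp (L * δ) * 1 :=
        mul_le_mul_of_nonneg_left (hmarkov.trans (hF1 n)) (Real.exp_nonneg _)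
    _ = Real.exp (L * δ) := mul_one _
end

section
/- Let n ≥ 2 and let G = (V,E,w) be a weighted digraph on n vertices with nonnegative integer edge weights w. Define perturbed weights w′(e) = w(e)·n^{10} + n^{9} + λ(e), where each λ(e) is an integer with 0 ≤ λ(e) < n^{8}. Then for every path p in G with 1 ≤ |p| ≤ n−1, the hop of p is recoverable from its perturbed weight: ⌊ (w′(p) mod n^{10}) / n^{9} ⌋ = |p|, where w′(p) denotes the sum of the perturbed weights of the edges of p. In particular, any two paths with at most n−1 edges and equal perturbed weight have equal hop. -/
/-- The integer weight of a path: the sum of the weights of its consecutive edges. -/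
def pweightZ {V : Type*} (w : V → V → ℤ) (p : List V) : ℤ :=
  ((p.zip p.tail).map fun e => w e.1 e.2).sum

/-- The perturbed weight `w'(e) = w(e)·n¹⁰ + n⁹ + λ(e)` of an edge. -/
def wPert {V : Type*} (n : ℕ) (w lam : V → V → ℤ) (u v : V) : ℤ :=
  w u v * (n : ℤ) ^ 10 + (n : ℤ) ^ 9 + lam u v

/-- The perturbed weight of a path splits into a multiple of `n¹⁰`, its hop times `n⁹`, and the
total perturbation, which is at most the hop times `n⁸`. -/
theorem exists_pweightZ_wPert_eq {V : Type*} (n : ℕ) (E : V → V → Prop) (w lam : V → V → ℤ)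
    (hlam : ∀ u v : V, E u v → 0 ≤ lam u v ∧ lam u v < (n : ℤ) ^ 8) (p : List V)
    (hp : p.IsChain E) :
    ∃ W L : ℤ, pweightZ (wPert n w lam) p = W * (n : ℤ) ^ 10 + (hop p : ℤ) * (n : ℤ) ^ 9 + L ∧
      0 ≤ L ∧ L ≤ (hop p : ℤ) * (n : ℤ) ^ 8 := by
  induction p with
  | nil => exact ⟨0, 0, by simp [pweightZ, hop]⟩
  | cons a l ih =>
    cases l with
    | nil => exact ⟨0, 0, by simp [pweightZ, hop]⟩
    | cons b l =>
      rw [List.isChain_cons_cons] at hp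
      obtain ⟨W, L, h, h0, h1⟩ := ih hp.2
      obtain ⟨l0, l1⟩ := hlam a b hp.1
      have hh : (hop (a :: b :: l) : ℤ) = hop (b :: l) + 1 := by simp [hop]
      have hs : pweightZ (wPert n w lam) (a :: b :: l) =
          wPert n w lam a b + pweightZ (wPert n w lam) (b :: l) := by simp [pweightZ]
      refine ⟨W + w a b, L + lam a b, ?_, by linarith, ?_⟩
      · rw [hs, h, hh, wPert]
        ring
      · rw [hh]
        linarith

/-- The hop of a path with fewer than `n` edges is a digit of its perturbed weight. -/
theorem pweightZ_wPert_emod_ediv {V : Type*} (n : ℕ) (hn : 2 ≤ n) (E : V → V → Prop)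
    (w lam : V → V → ℤ)
    (hlam : ∀ u v : V, E u v → 0 ≤ lam u v ∧ lam u v < (n : ℤ) ^ 8) (p : List V)
    (hp : p.IsChain E) (hop_le : hop p ≤ n - 1) :
    (pweightZ (wPert n w lam) p % (n : ℤ) ^ 10) / (n : ℤ) ^ 9 = (hop p : ℤ) := by
  obtain ⟨W, L, h, h0, h1⟩ := exists_pweightZ_wPert_eq n E w lam hlam p hp
  have hlt : (hop p : ℤ) + 1 ≤ n := by omega
  have hn0 : (0 : ℤ) < n := by omega
  have h8 : (0 : ℤ) < (n : ℤ) ^ 8 := by positivity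
  have h9 : (0 : ℤ) < (n : ℤ) ^ 9 := by positivity
  have hL : L < (n : ℤ) ^ 9 := by
    have : ((hop p : ℤ) + 1) * (n : ℤ) ^ 8 ≤ n * (n : ℤ) ^ 8 := by gcongr
    linarith [pow_succ' (n : ℤ) 8]
  have hT : (hop p : ℤ) * (n : ℤ) ^ 9 + L < (n : ℤ) ^ 10 := by
    have : ((hop p : ℤ) + 1) * (n : ℤ) ^ 9 ≤ n * (n : ℤ) ^ 9 := by gcongr
    linarith [pow_succ' (n : ℤ) 9]
  have hmod : pweightZ (wPert n w lam) p % (n : ℤ) ^ 10 = L + (hop p : ℤ) * (n : ℤ) ^ 9 := by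
    rw [h, add_assoc, add_comm, Int.add_mul_emod_self_right, Int.emod_eq_of_lt (by positivity) hT,
      add_comm]
  rw [hmod, Int.add_mul_ediv_right _ _ h9.ne', Int.ediv_eq_zero_of_lt h0 hL, zero_add]

/-- let `n ≥ 2` and `G` a weighted digraph on `n` vertices with nonnegative
integer edge weights `w`, and perturbed weights `w'(e) = w(e)·n¹⁰ + n⁹ + λ(e)` where
`0 ≤ λ(e) < n⁸`. Then for every path `p` in `G` with `1 ≤ |p| ≤ n-1`,
`⌊(w'(p) mod n¹⁰) / n⁹⌋ = |p|`; in particular any two paths with at most `n-1` edges and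
equal perturbed weight have equal hop. -/
theorem stmt_14 {V : Type*} [Fintype V] (n : ℕ) (hn : 2 ≤ n) (hcard : Fintype.card V = n)
    (E : V → V → Prop) (w : V → V → ℤ) (hw : ∀ u v : V, E u v → 0 ≤ w u v)
    (lam : V → V → ℤ)
    (hlam : ∀ u v : V, E u v → 0 ≤ lam u v ∧ lam u v < (n : ℤ) ^ 8) :
    (∀ p : List V, p ≠ [] → p.Chain' E → 1 ≤ hop p → hop p ≤ n - 1 →
      (pweightZ (wPert n w lam) p % (n : ℤ) ^ 10) / (n : ℤ) ^ 9 = (hop p : ℤ)) ∧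
    (∀ p q : List V, p ≠ [] → p.Chain' E → q ≠ [] → q.Chain' E →
      hop p ≤ n - 1 → hop q ≤ n - 1 →
      pweightZ (wPert n w lam) p = pweightZ (wPert n w lam) q → hop p = hop q) := by
  have key := pweightZ_wPert_emod_ediv n hn E w lam hlam
  refine ⟨fun p _ hp _ hle => key p hp hle, fun p q _ hp _ hq hlp hlq heq => ?_⟩
  have hpq := key p hp hlp
  rw [heq, key q hq hlq] at hpq
  exact_mod_cast hpq.symm
end

section
/- Let n ≥ 2 and let G = (V,E,w) be a weighted digraph on n vertices with nonnegative integer edge weights w. Define perturbed weights w′(e) = w(e)·n^{10} + n^{9} + λ(e), where each λ(e) is an integer with 0 ≤ λ(e) < n^{8}. Then for any two paths p and q, each having at most n−1 edges, w′(p) ≤ w′(q) implies w(p) ≤ w(q). Consequently, for any s, t ∈ V and any h ≤ n−1, every path from s to t that has minimum w′-weight among s-t paths with hop at most h also has minimum w-weight among s-t paths with hop at most h. -/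
theorem pweightZ_cons_cons {V : Type*} (w : V → V → ℤ) (a b : V) (l : List V) :
    pweightZ w (a :: b :: l) = w a b + pweightZ w (b :: l) := by
  simp [pweightZ]

/-- The perturbed weight of a path exceeds `n¹⁰` times its weight by at most
`n⁹ + n⁸` per edge. -/
theorem pweightZ_wPert_bounds {V : Type*} {n : ℕ} {E : V → V → Prop} (w : V → V → ℤ)
    {lam : V → V → ℤ}
    (hlam : ∀ u v : V, E u v → 0 ≤ lam u v ∧ lam u v < (n : ℤ) ^ 8)
    (p : List V) (hp : p.IsChain E) :
    pweightZ w p * (n : ℤ) ^ 10 ≤ pweightZ (wPert n w lam) p ∧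
      pweightZ (wPert n w lam) p ≤
        pweightZ w p * (n : ℤ) ^ 10 + (hop p : ℤ) * ((n : ℤ) ^ 9 + (n : ℤ) ^ 8) := by
  induction p with
  | nil => simp [pweightZ, hop]
  | cons a l ih =>
    cases l with
    | nil => simp [pweightZ, hop]
    | cons b l =>
      rw [List.isChain_cons_cons] at hp
      obtain ⟨ihl, ihu⟩ := ih hp.2
      obtain ⟨h0, h1⟩ := hlam a b hp.1
      have hhop : (hop (a :: b :: l) : ℤ) = hop (b :: l) + 1 := by simp [hop]
      have h9 : (0 : ℤ) ≤ (n : ℤ) ^ 9 := by positivity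
      simp only [pweightZ_cons_cons, hhop, wPert]
      constructor <;> linarith

theorem pweightZ_le_of_wPert_le {V : Type*} {n : ℕ} (hn : 1 ≤ n) {E : V → V → Prop}
    (w : V → V → ℤ) {lam : V → V → ℤ}
    (hlam : ∀ u v : V, E u v → 0 ≤ lam u v ∧ lam u v < (n : ℤ) ^ 8)
    {p q : List V} (hp : p.IsChain E) (hq : q.IsChain E) (hhop : hop q ≤ n - 1)
    (hle : pweightZ (wPert n w lam) p ≤ pweightZ (wPert n w lam) q) :
    pweightZ w p ≤ pweightZ w q := by
  have hlow := (pweightZ_wPert_bounds w hlam p hp).1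
  have hupp := (pweightZ_wPert_bounds w hlam q hq).2
  have hhop' : (hop q : ℤ) ≤ (n : ℤ) - 1 := by omega
  have hpos : (0 : ℤ) < (n : ℤ) ^ 8 := by positivity
  have hextra : (hop q : ℤ) * ((n : ℤ) ^ 9 + (n : ℤ) ^ 8) ≤
      ((n : ℤ) - 1) * ((n : ℤ) ^ 9 + (n : ℤ) ^ 8) :=
    mul_le_mul_of_nonneg_right hhop' (by positivity)
  have hlt : pweightZ w p * (n : ℤ) ^ 10 < (pweightZ w q + 1) * (n : ℤ) ^ 10 := by
    linarith
  exact Int.lt_add_one_iff.mp (lt_of_mul_lt_mul_right hlt (by positivity))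

/-- let `n ≥ 2` and `G` a weighted digraph on `n` vertices with nonnegative
integer edge weights `w`, and perturbed weights `w'(e) = w(e)·n¹⁰ + n⁹ + λ(e)` where
`0 ≤ λ(e) < n⁸`. Then for any two paths `p, q` with at most `n-1` edges each,
`w'(p) ≤ w'(q)` implies `w(p) ≤ w(q)`; consequently, for any `s, t` and `h ≤ n-1`, every
`s`-`t` path of minimum `w'`-weight among `s`-`t` paths with hop at most `h` also has
minimum `w`-weight among `s`-`t` paths with hop at most `h`. -/
theorem stmt_15 {V : Type*} [Fintype V] (n : ℕ) (hn : 2 ≤ n) (hcard : Fintype.card V = n)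
    (E : V → V → Prop) (w : V → V → ℤ) (hw : ∀ u v : V, E u v → 0 ≤ w u v)
    (lam : V → V → ℤ)
    (hlam : ∀ u v : V, E u v → 0 ≤ lam u v ∧ lam u v < (n : ℤ) ^ 8) :
    (∀ p q : List V, p ≠ [] → p.Chain' E → q ≠ [] → q.Chain' E →
      hop p ≤ n - 1 → hop q ≤ n - 1 →
      pweightZ (wPert n w lam) p ≤ pweightZ (wPert n w lam) q →
      pweightZ w p ≤ pweightZ w q) ∧
    (∀ s t : V, ∀ h : ℕ, h ≤ n - 1 →
      ∀ p : List V, IsPath E p s t → hop p ≤ h →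
      (∀ q : List V, IsPath E q s t → hop q ≤ h →
        pweightZ (wPert n w lam) p ≤ pweightZ (wPert n w lam) q) →
      (∀ q : List V, IsPath E q s t → hop q ≤ h →
        pweightZ w p ≤ pweightZ w q)) := by
  have hn1 : 1 ≤ n := by omega
  exact ⟨fun p q _ hp _ hq _ hhop hle => pweightZ_le_of_wPert_le hn1 w hlam hp hq hhop hle,
    fun s t h hh p hp _ hmin q hq hhop =>
      pweightZ_le_of_wPert_le hn1 w hlam hp.2.2.2 hq.2.2.2 (hhop.trans hh) (hmin q hq hhop)⟩
end

section
/- Let G = (V,E,w) be a weighted digraph and C ⊆ V. Define the split digraph G′ on vertex set V×{0,1} as follows: for each edge (u,v) ∈ E, G′ has edges ((u,0),(v,0)) and ((u,1),(v,1)) of weight w(u,v), and additionally, if v ∈ C, the edge ((u,0),(v,1)) of weight w(u,v). For s ∈ V let σ(s) = (s,1) if s ∈ C and σ(s) = (s,0) otherwise. Then for all s, t ∈ V and every hop bound h ≥ 0, the minimum weight of a path in G′ from σ(s) to (t,1) with hop at most h equals the minimum weight of a path in G from s to t with hop at most h that visits at least one vertex of C (both minima being ∞ when no such path exists). -/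
/-- The edge relation of the split digraph `G'` on `V × Bool`: for each edge `(u,v)` of `G`
there are edges `((u,0),(v,0))` and `((u,1),(v,1))`, and additionally `((u,0),(v,1))`
whenever `v ∈ C`. -/
def splitRel {V : Type*} (E : V → V → Prop) (C : Set V) :
    V × Bool → V × Bool → Prop :=
  fun a b => E a.1 b.1 ∧ (a.2 = b.2 ∨ (a.2 = false ∧ b.2 = true ∧ b.1 ∈ C))

theorem hop_map {V W : Type*} (f : V → W) (p : List V) : hop (p.map f) = hop p := by
  simp [hop]

theorem pweight_map {V W : Type*} (f : V → W) (w : W → W → ℝ) (p : List V) :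
    pweight w (p.map f) = pweight (fun a b => w (f a) (f b)) p := by
  simp only [pweight, ← List.map_tail, List.zip_map, List.map_map]
  rfl

theorem IsPath.map {V W : Type*} {E : V → V → Prop} {F : W → W → Prop} {f : V → W}
    (hf : ∀ a b, E a b → F (f a) (f b)) {p : List V} {s t : V} (hp : IsPath E p s t) :
    IsPath F (p.map f) (f s) (f t) := by
  obtain ⟨h0, h1, h2, h3⟩ := hp
  exact ⟨by simpa using h0, by simp [h1], by simp [h2],
    (List.isChain_map f).2 (h3.imp hf)⟩

theorem isPath_cons_cons {V : Type*} {E : V → V → Prop} {a b s t : V} {l : List V} :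
    IsPath E (a :: b :: l) s t ↔ a = s ∧ E a b ∧ IsPath E (b :: l) b t := by
  simp only [IsPath, List.Chain', List.isChain_cons_cons, List.getLast?_cons_cons]
  simp
  tauto

/-- A path of the split digraph that changes layer visits `C`. -/
theorem IsPath.exists_mem_of_split {V : Type*} {E : V → V → Prop} {C : Set V}
    {p : List (V × Bool)} {s t : V} (hp : IsPath (splitRel E C) p (s, false) (t, true)) :
    ∃ v ∈ p.map Prod.fst, v ∈ C := by
  induction p generalizing s with
  | nil => exact absurd rfl hp.1
  | cons a l ih =>
    cases l with
    | nil => simp [IsPath] at hp; grind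
    | cons b l =>
      obtain ⟨rfl, hE, hp⟩ := isPath_cons_cons.1 hp
      obtain ⟨v, i⟩ := b
      cases i with
      | false =>
        obtain ⟨x, hx, hxC⟩ := ih hp
        exact ⟨x, List.mem_cons_of_mem _ hx, hxC⟩
      | true => exact ⟨v, by simp, by simpa [splitRel] using hE.2⟩

/-- A path that visits `C` after its first vertex lifts to a path of the split digraph
that changes layer. -/
theorem IsPath.exists_split_lift {V : Type*} {E : V → V → Prop} {C : Set V}
    {p : List V} {s t : V} (hp : IsPath E p s t) (hC : ∃ v ∈ p.tail, v ∈ C) :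
    ∃ q : List (V × Bool), IsPath (splitRel E C) q (s, false) (t, true) ∧
      q.map Prod.fst = p := by
  induction p generalizing s with
  | nil => exact absurd rfl hp.1
  | cons a l ih =>
    cases l with
    | nil => simp at hC
    | cons b l =>
      obtain ⟨rfl, hE, hp⟩ := isPath_cons_cons.1 hp
      by_cases hb : b ∈ C
      · refine ⟨(a, false) :: (b, true) :: l.map (·, true), isPath_cons_cons.2
          ⟨rfl, ⟨hE, Or.inr ⟨rfl, rfl, hb⟩⟩, ?_⟩, by simp [Function.comp_def]⟩
        exact hp.map (f := (·, true)) fun _ _ h => ⟨h, Or.inl rfl⟩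
      · obtain ⟨q, hq, hqp⟩ := ih hp (by simpa [hb] using hC)
        match q, hq, hqp with
        | [], hq, _ => exact absurd rfl hq.1
        | c :: q, hq, hqp =>
          obtain rfl : c = (b, false) := by simpa using hq.2.1
          exact ⟨(a, false) :: (b, false) :: q,
            isPath_cons_cons.2 ⟨rfl, ⟨hE, Or.inl rfl⟩, hq⟩, by simp [← hqp]⟩

/-- for every `s, t` and every hop bound `h`, the minimum weight of a path in
the split digraph `G'` from `σ(s)` to `(t,1)` with hop at most `h` (where `σ(s) = (s,1)`
if `s ∈ C` and `(s,0)` otherwise, and each copied edge keeps its original weight) equals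
the minimum weight of a path in `G` from `s` to `t` with hop at most `h` that visits at
least one vertex of `C` (both minima taken in `EReal`, so `∞` when no such path exists). -/
theorem stmt_16 {V : Type*} [Fintype V] (E : V → V → Prop) (w : V → V → ℝ)
    (C : Set V) [DecidablePred (· ∈ C)] (s t : V) (h : ℕ) :
    sInf {x : EReal | ∃ p : List (V × Bool),
        IsPath (splitRel E C) p (s, if s ∈ C then true else false) (t, true) ∧
        hop p ≤ h ∧ x = (pweight (fun a b => w a.1 b.1) p : EReal)} =
    sInf {x : EReal | ∃ p : List V, IsPath E p s t ∧ hop p ≤ h ∧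
        (∃ v ∈ p, v ∈ C) ∧ x = (pweight w p : EReal)} := by
  congr 1
  ext x
  constructor
  · rintro ⟨p, hp, hh, rfl⟩
    refine ⟨p.map Prod.fst, hp.map (f := Prod.fst) fun _ _ h => h.1, by rwa [hop_map], ?_,
      by rw [pweight_map]⟩
    by_cases hs : s ∈ C
    · exact ⟨s, List.mem_map.2 ⟨_, List.mem_of_head? hp.2.1, rfl⟩, hs⟩
    · rw [if_neg hs] at hp
      exact hp.exists_mem_of_split
  · rintro ⟨p, hp, hh, hC, rfl⟩
    obtain ⟨q, hq, rfl⟩ : ∃ q : List (V × Bool),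
        IsPath (splitRel E C) q (s, if s ∈ C then true else false) (t, true) ∧
          q.map Prod.fst = p := by
      by_cases hs : s ∈ C
      · rw [if_pos hs]
        exact ⟨p.map (·, true), hp.map (f := (·, true)) fun _ _ h => ⟨h, Or.inl rfl⟩,
          by simp [Function.comp_def]⟩
      · rw [if_neg hs]
        refine hp.exists_split_lift ?_
        cases p with
        | nil => exact absurd rfl hp.1
        | cons a l =>
          obtain rfl : a = s := by simpa using hp.2.1
          simpa [hs] using hC
    exact ⟨q, hq, by rwa [hop_map] at hh, by rw [pweight_map]⟩
end
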